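/- arXiv:2103.14966 — 4 statements merged into one kernel-verified Lean document; each statement's English description precedes it below -/
import Mathlib

section
/- Let a > 1/2 and M > 0, and let (g_k)_{k ≥ 2} be a sequence of real numbers such that for every natural number n ≥ 1 one has ∑_{k = 2^{n-1}+1}^{2^n} |g_k|² ≤ M² · (2^{-(n+1)})^{2a}. Then the series ∑_{k ≥ 2} (log k + 1)|g_k| converges (the family ((log k + 1)|g_k|)_{k ≥ 2} is summable). -/
/-- A nonnegative sequence is summable if its sums over the dyadic blocks `(2 ^ m, 2 ^ (m + 1)]`
form a summable sequence. -/
theorem summable_of_summable_dyadic_blocks {f : ℕ → ℝ} (hf : ∀ k, 0 ≤ f k)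
    (h : Summable fun m : ℕ => ∑ k ∈ Finset.Icc (2 ^ m + 1) (2 ^ (m + 1)), f k) :
    Summable f := by
  have partial_sum (N : ℕ) : ∑ k ∈ Finset.range (2 ^ N + 1), f k
      = f 0 + f 1 + ∑ m ∈ Finset.range N, ∑ k ∈ Finset.Icc (2 ^ m + 1) (2 ^ (m + 1)), f k := by
    induction N with
    | zero => simp [Finset.sum_range_succ]
    | succ N ih =>
      have hle : 2 ^ N + 1 ≤ 2 ^ (N + 1) + 1 := by gcongr <;> omega
      rw [Finset.sum_range_succ _ N, ← add_assoc, ← ih, ← Finset.sum_range_add_sum_Ico f hle]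
      congr 1
  refine summable_of_sum_range_le
    (c := f 0 + f 1 + ∑' m : ℕ, ∑ k ∈ Finset.Icc (2 ^ m + 1) (2 ^ (m + 1)), f k) hf fun n => ?_
  calc ∑ k ∈ Finset.range n, f k ≤ ∑ k ∈ Finset.range (2 ^ n + 1), f k := by
        refine Finset.sum_le_sum_of_subset_of_nonneg ?_ fun i _ _ => hf i
        exact Finset.range_mono (Nat.lt_two_pow_self.le.trans (Nat.le_succ _))
    _ ≤ _ := by
        rw [partial_sum]
        gcongr
        exact h.sum_le_tsum _ fun m _ => Finset.sum_nonneg fun k _ => hf k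

/-- Cauchy–Schwarz on a dyadic block. -/
theorem sum_abs_dyadic_block_le {a M : ℝ} (hM : 0 ≤ M) (g : ℕ → ℝ) (m : ℕ)
    (hg : ∑ k ∈ Finset.Icc (2 ^ m + 1) (2 ^ (m + 1)), |g k| ^ 2
      ≤ M ^ 2 * ((2 : ℝ) ^ (-((m : ℝ) + 2))) ^ (2 * a)) :
    ∑ k ∈ Finset.Icc (2 ^ m + 1) (2 ^ (m + 1)), |g k|
      ≤ M * (2 : ℝ) ^ (-(2 * a)) * ((2 : ℝ) ^ (1 / 2 - a)) ^ m := by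
  refine le_of_sq_le_sq ?_ (by positivity)
  have hcard : (Finset.Icc (2 ^ m + 1) (2 ^ (m + 1))).card = 2 ^ m := by
    rw [Nat.card_Icc, pow_succ]; omega
  calc (∑ k ∈ Finset.Icc (2 ^ m + 1) (2 ^ (m + 1)), |g k|) ^ 2
      ≤ 2 ^ m * ∑ k ∈ Finset.Icc (2 ^ m + 1) (2 ^ (m + 1)), |g k| ^ 2 := by
        have := sq_sum_le_card_mul_sum_sq (s := Finset.Icc (2 ^ m + 1) (2 ^ (m + 1)))
          (f := fun k => |g k|)
        rw [hcard] at this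
        exact_mod_cast this
    _ ≤ 2 ^ m * (M ^ 2 * ((2 : ℝ) ^ (-((m : ℝ) + 2))) ^ (2 * a)) := by gcongr
    _ = M ^ 2 * (2 : ℝ) ^ ((m : ℝ) + -((m : ℝ) + 2) * (2 * a)) := by
        rw [Real.rpow_add two_pos, Real.rpow_mul zero_le_two, Real.rpow_natCast]; ring
    _ = (M * (2 : ℝ) ^ (-(2 * a)) * ((2 : ℝ) ^ (1 / 2 - a)) ^ m) ^ 2 := by
        rw [← Real.rpow_natCast _ m, ← Real.rpow_mul zero_le_two, mul_assoc,
          ← Real.rpow_add two_pos, mul_pow, ← Real.rpow_natCast _ 2,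
          ← Real.rpow_natCast (2 ^ _ : ℝ) 2, ← Real.rpow_mul zero_le_two]
        congr 2
        push_cast
        ring

/-- If `a > 1/2`, `M > 0` and the dyadic blocks of the sequence `g` satisfy
`∑_{k=2^{n-1}+1}^{2^n} |g_k|² ≤ M² (2^{-(n+1)})^{2a}` for all `n ≥ 1`, then the family
`((log k + 1)|g_k|)_{k ≥ 2}` is summable. -/
theorem stmt2 (a M : ℝ) (ha : 1 / 2 < a) (hM : 0 < M) (g : ℕ → ℝ)
    (hg : ∀ n : ℕ, 1 ≤ n →
      ∑ k ∈ Finset.Icc (2 ^ (n - 1) + 1) (2 ^ n : ℕ), |g k| ^ 2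
        ≤ M ^ 2 * ((2 : ℝ) ^ (-((n : ℝ) + 1))) ^ (2 * a)) :
    Summable (fun k : ℕ => if 2 ≤ k then (Real.log (k : ℝ) + 1) * |g k| else 0) := by
  have hf (k : ℕ) : 0 ≤ if 2 ≤ k then (Real.log (k : ℝ) + 1) * |g k| else 0 := by
    have := Real.log_natCast_nonneg k
    positivity
  refine summable_of_summable_dyadic_blocks hf ?_
  set s : ℝ := (2 : ℝ) ^ (1 / 2 - a)
  have hs0 : 0 < s := by positivity
  have hs1 : ‖s‖ < 1 := by
    rw [Real.norm_of_nonneg hs0.le]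
    exact Real.rpow_lt_one_of_one_lt_of_neg one_lt_two (by linarith)
  have hsum : Summable fun m : ℕ => ((m : ℝ) + 2) * (M * (2 : ℝ) ^ (-(2 * a)) * s ^ m) := by
    have h1 := summable_pow_mul_geometric_of_norm_lt_one 1 hs1
    have h0 := summable_geometric_of_norm_lt_one hs1
    refine ((h1.add (h0.mul_left 2)).mul_left (M * (2 : ℝ) ^ (-(2 * a)))).congr fun m => ?_
    ring
  refine Summable.of_nonneg_of_le (fun m => Finset.sum_nonneg fun k _ => hf k) (fun m => ?_) hsum
  have hblock := sum_abs_dyadic_block_le (a := a) hM.le g m (by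
    have := hg (m + 1) (by omega)
    simp only [Nat.add_sub_cancel] at this
    convert this using 4
    push_cast
    ring)
  refine le_trans ?_ (mul_le_mul_of_nonneg_left hblock (by positivity))
  rw [Finset.mul_sum]
  refine Finset.sum_le_sum fun k hk => ?_
  obtain ⟨hk1, hk2⟩ := Finset.mem_Icc.mp hk
  have hpow : 0 < 2 ^ m := by positivity
  rw [if_pos (by omega)]
  refine mul_le_mul_of_nonneg_right ?_ (abs_nonneg _)
  have hlog : Real.log k ≤ ((m : ℝ) + 1) * Real.log 2 := by
    have : Real.log k ≤ Real.log ((2 : ℝ) ^ (m + 1)) :=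
      Real.log_le_log (by exact_mod_cast (by omega : 0 < k)) (by exact_mod_cast hk2)
    rwa [Real.log_pow, Nat.cast_add_one] at this
  have hlog2 : Real.log 2 ≤ 1 := by linarith [Real.log_two_lt_d9]
  nlinarith [Nat.cast_nonneg (α := ℝ) m]
end

section
/- Let 0 < α₀ < 1 and let t₀ ≥ e^{1 − γ_EM} · e^{2/α₀}. Then for every α with α₀ ≤ α ≤ 1 one has α(1 − α)(log t₀ − Ψ(2 − α)) + 2α − 1 ≥ 1, where Ψ(x) = Γ'(x)/Γ(x) is the digamma function and γ_EM is the Euler–Mascheroni constant. -/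
open Real

/-- The logarithmic derivative of the Gamma function is monotone on the positive reals. -/
theorem monotoneOn_deriv_Gamma_div_Gamma :
    MonotoneOn (fun x : ℝ => deriv Real.Gamma x / Real.Gamma x) (Set.Ioi 0) := by
  have hΓ : ∀ x ∈ Set.Ioi (0 : ℝ), DifferentiableAt ℝ Real.Gamma x := fun x hx =>
    Real.differentiableAt_Gamma fun m => by
      have hm : (0 : ℝ) ≤ m := m.cast_nonneg
      have hx' : 0 < x := hx
      linarith
  have hmono := Real.convexOn_log_Gamma.monotoneOn_deriv fun x hx =>
    (hΓ x hx).log (Real.Gamma_pos_of_pos hx).ne'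
  refine hmono.congr fun x hx => ?_
  exact deriv.log (hΓ x hx) (Real.Gamma_pos_of_pos hx).ne'

theorem deriv_Gamma_two_div_Gamma_two :
    deriv Real.Gamma 2 / Real.Gamma 2 = 1 - Real.eulerMascheroniConstant := by
  have h := Real.deriv_Gamma_nat 1
  norm_num at h
  rw [h, Real.Gamma_two]
  ring

/-- For `0 < α₀ < 1` and `t₀ ≥ e^{1 − γ_EM} e^{2/α₀}`, every `α ∈ [α₀, 1]` satisfies
`α(1 − α)(log t₀ − Ψ(2 − α)) + 2α − 1 ≥ 1`, where `Ψ(x) = Γ'(x)/Γ(x)`. -/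
theorem stmt7 (α₀ t₀ : ℝ) (hα₀ : 0 < α₀) (hα₀1 : α₀ < 1)
    (ht₀ : Real.exp (1 - Real.eulerMascheroniConstant) * Real.exp (2 / α₀) ≤ t₀) :
    ∀ α : ℝ, α₀ ≤ α → α ≤ 1 →
      1 ≤ α * (1 - α) * (Real.log t₀ - deriv Real.Gamma (2 - α) / Real.Gamma (2 - α))
        + 2 * α - 1 := by
  intro α hα hα1
  have hαpos : 0 < α := hα₀.trans_le hα
  have hlog : 1 - Real.eulerMascheroniConstant + 2 / α₀ ≤ Real.log t₀ := by
    rw [← Real.exp_add] at ht₀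
    exact (Real.le_log_iff_exp_le ((Real.exp_pos _).trans_le ht₀)).2 ht₀
  have hdiv : 2 / α ≤ 2 / α₀ := by gcongr
  have hψ : deriv Real.Gamma (2 - α) / Real.Gamma (2 - α)
      ≤ 1 - Real.eulerMascheroniConstant := by
    rw [← deriv_Gamma_two_div_Gamma_two]
    exact monotoneOn_deriv_Gamma_div_Gamma (Set.mem_Ioi.2 (by linarith))
      (Set.mem_Ioi.2 two_pos) (by linarith)
  have hmul := mul_le_mul_of_nonneg_left
    (show 2 / α ≤ Real.log t₀ - deriv Real.Gamma (2 - α) / Real.Gamma (2 - α) by linarith)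
    (mul_nonneg hαpos.le (sub_nonneg.2 hα1))
  have heq : α * (1 - α) * (2 / α) = 2 * (1 - α) := by field_simp
  linarith
end

section
/- Let λ > 0 and t₀ ≥ e. Define q₁(α) = 1 / (λ² t₀^{α} Γ(1 − α)) for α ∈ (0, 1). Then q₁ is differentiable on (0, 1) and for every α ∈ (0, 1): −q₁'(α) = (1/(λ² t₀^{α})) · ((1 − α)(log t₀ − Ψ(2 − α)) + 1) / Γ(2 − α), and moreover −q₁'(α) ≥ 1 / (λ² t₀^{α}). -/
open Real

/-- The digamma function is bounded by the logarithm on the positive reals. -/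
theorem Real.deriv_Gamma_div_Gamma_le_log {x : ℝ} (hx : 0 < x) :
    deriv Real.Gamma x / Real.Gamma x ≤ Real.log x := by
  have hΓ := Real.Gamma_pos_of_pos hx
  have hd : HasDerivAt (Real.log ∘ Real.Gamma) (deriv Real.Gamma x / Real.Gamma x) x :=
    (Real.differentiableOn_Gamma_Ioi.differentiableAt (Ioi_mem_nhds hx)).hasDerivAt.log hΓ.ne'
  have h := Real.convexOn_log_Gamma.le_slope_of_hasDerivAt (Set.mem_Ioi.2 hx)
    (Set.mem_Ioi.2 (by linarith : 0 < x + 1)) (by linarith) hd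
  rwa [slope_def_field, Function.comp_apply, Function.comp_apply, Real.Gamma_add_one hx.ne',
    Real.log_mul hx.ne' hΓ.ne', add_sub_cancel_right, add_sub_cancel_left, div_one] at h

theorem Real.Gamma_le_one {x : ℝ} (h1 : 1 ≤ x) (h2 : x ≤ 2) : Real.Gamma x ≤ 1 := by
  have h := Real.convexOn_Gamma.2 (Set.mem_Ioi.2 one_pos) (Set.mem_Ioi.2 two_pos)
    (sub_nonneg.2 h2) (sub_nonneg.2 h1) (by ring)
  simp only [smul_eq_mul, Real.Gamma_one, Real.Gamma_two] at h
  ring_nf at h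
  exact h

theorem hasDerivAt_one_div_mul_rpow_mul_Gamma_one_sub {c t α : ℝ} (hc : c ≠ 0) (ht : 0 < t)
    (hα : α < 1) :
    HasDerivAt (fun β : ℝ => 1 / (c * t ^ β * Real.Gamma (1 - β)))
      (-((1 / (c * t ^ α)) *
        (((1 - α) * (Real.log t - deriv Real.Gamma (2 - α) / Real.Gamma (2 - α)) + 1)
          / Real.Gamma (2 - α)))) α := by
  have hΓ : 0 < Real.Gamma (2 - α) := Real.Gamma_pos_of_pos (by linarith)
  have htα : 0 < t ^ α := Real.rpow_pos_of_pos ht α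
  have heq : (fun β : ℝ => 1 / (c * t ^ β * Real.Gamma (1 - β))) =ᶠ[nhds α]
      fun β => (1 - β) / (c * t ^ β * Real.Gamma (2 - β)) := by
    filter_upwards [Iio_mem_nhds hα] with β hβ
    have hβ' : 1 - β ≠ 0 := (sub_pos.2 hβ).ne'
    rw [show (2 : ℝ) - β = (1 - β) + 1 by ring, Real.Gamma_add_one hβ', mul_left_comm,
      div_mul_cancel_left₀ hβ', one_div]
  have hG : HasDerivAt (fun β : ℝ => Real.Gamma (2 - β)) (-deriv Real.Gamma (2 - α)) α :=
    (Real.differentiableOn_Gamma_Ioi.differentiableAt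
      (Ioi_mem_nhds (by linarith : 0 < 2 - α))).hasDerivAt.comp_const_sub 2 α
  have hr : HasDerivAt (fun β : ℝ => t ^ β) (t ^ α * Real.log t) α :=
    (Real.hasStrictDerivAt_const_rpow ht α).hasDerivAt
  have hq := ((hasDerivAt_id α).const_sub 1).div ((hr.const_mul c).mul hG)
    (mul_ne_zero (mul_ne_zero hc htα.ne') hΓ.ne')
  refine (hq.congr_of_eventuallyEq heq).congr_deriv ?_
  simp only [Pi.mul_apply, id]
  field_simp
  ring

/-- For `λ > 0` and `t₀ ≥ e`, the function `q₁(α) = 1/(λ² t₀^{α} Γ(1 − α))` is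
differentiable on `(0, 1)` with
`−q₁'(α) = (1/(λ² t₀^{α})) · ((1 − α)(log t₀ − Ψ(2 − α)) + 1)/Γ(2 − α)` and
`−q₁'(α) ≥ 1/(λ² t₀^{α})` there. -/
theorem stmt9 (l t₀ : ℝ) (hl : 0 < l) (ht₀ : Real.exp 1 ≤ t₀) :
    ∀ α ∈ Set.Ioo (0 : ℝ) 1,
      DifferentiableAt ℝ
        (fun β : ℝ => 1 / (l ^ 2 * t₀ ^ β * Real.Gamma (1 - β))) α ∧
      -deriv (fun β : ℝ => 1 / (l ^ 2 * t₀ ^ β * Real.Gamma (1 - β))) α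
        = (1 / (l ^ 2 * t₀ ^ α)) *
          (((1 - α) * (Real.log t₀ - deriv Real.Gamma (2 - α) / Real.Gamma (2 - α)) + 1)
            / Real.Gamma (2 - α)) ∧
      1 / (l ^ 2 * t₀ ^ α)
        ≤ -deriv (fun β : ℝ => 1 / (l ^ 2 * t₀ ^ β * Real.Gamma (1 - β))) α := by
  intro α ⟨h0, h1⟩
  have ht : 0 < t₀ := (Real.exp_pos 1).trans_le ht₀
  have hd := hasDerivAt_one_div_mul_rpow_mul_Gamma_one_sub (pow_pos hl 2).ne' ht h1
  refine ⟨hd.differentiableAt, by rw [hd.deriv, neg_neg], ?_⟩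
  rw [hd.deriv, neg_neg]
  have hlog : 1 ≤ Real.log t₀ := (Real.le_log_iff_exp_le ht).2 ht₀
  have hx : 0 < 2 - α := by linarith
  have hψ := Real.deriv_Gamma_div_Gamma_le_log hx
  have hlog' := Real.log_le_sub_one_of_pos hx
  have hΓ := Real.Gamma_le_one (by linarith : 1 ≤ 2 - α) (by linarith)
  have hm := mul_nonneg (sub_pos.2 h1).le
    (by linarith : 0 ≤ Real.log t₀ - deriv Real.Gamma (2 - α) / Real.Gamma (2 - α))
  refine le_mul_of_one_le_right (by positivity) ?_
  rw [one_le_div (Real.Gamma_pos_of_pos hx)]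
  linarith
end

section
/- Let 0 < α < 1, let λ ≥ 1, and let t > 0 satisfy λ t^{α} ≥ 1. Then ∫₀^t η^{α−1} / (1 + λ η^{α}) dη ≤ (1/λ) · ( 1/α + (1/α) log λ + |log t| ). -/
open Real MeasureTheory Set

theorem hasDerivAt_log_one_add_mul_rpow {α l x : ℝ} (hl : 0 ≤ l) (hx : 0 < x) :
    HasDerivAt (fun η : ℝ => Real.log (1 + l * η ^ α))
      (α * l * (x ^ (α - 1) / (1 + l * x ^ α))) x := by
  have hpos : 0 < 1 + l * x ^ α := by positivity
  have h := (((Real.hasDerivAt_rpow_const (p := α) (Or.inl hx.ne')).const_mul l).const_add 1).log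
    hpos.ne'
  convert h using 1
  ring

theorem integral_rpow_sub_one_div_one_add_mul_rpow {α l t : ℝ} (hα : 0 < α) (hl : 0 < l)
    (ht : 0 ≤ t) :
    ∫ η in Ioc (0 : ℝ) t, η ^ (α - 1) / (1 + l * η ^ α)
      = Real.log (1 + l * t ^ α) / (α * l) := by
  have hcont : ContinuousOn (fun η : ℝ => Real.log (1 + l * η ^ α)) (Icc 0 t) := by
    refine ContinuousOn.log ?_ fun x hx => ?_
    · exact ((Real.continuous_rpow_const hα.le).const_mul l |>.const_add 1).continuousOn
    · have := Real.rpow_nonneg hx.1 α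
      positivity
  have hderiv : ∀ x ∈ Ioo 0 t, HasDerivAt (fun η : ℝ => Real.log (1 + l * η ^ α))
      (α * l * (x ^ (α - 1) / (1 + l * x ^ α))) x :=
    fun x hx => hasDerivAt_log_one_add_mul_rpow hl.le hx.1
  have hint := intervalIntegral.integrableOn_deriv_of_nonneg hcont hderiv fun x hx => by
    have := hx.1
    positivity
  have hftc := intervalIntegral.integral_eq_sub_of_hasDerivAt_of_le ht hcont hderiv
    ((intervalIntegrable_iff_integrableOn_Ioc_of_le ht).2 hint)
  rw [intervalIntegral.integral_of_le ht, integral_const_mul] at hftc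
  rw [eq_div_iff (by positivity), mul_comm, hftc]
  simp [Real.zero_rpow hα.ne']

/-- For `0 < α < 1`, `λ ≥ 1` and `t > 0` with `λ t^α ≥ 1`,
`∫₀^t η^{α−1}/(1 + λ η^α) dη ≤ (1/λ)(1/α + (1/α) log λ + |log t|)`. -/
theorem stmt14 (α l t : ℝ) (hα : 0 < α) (hα1 : α < 1) (hl : 1 ≤ l) (ht : 0 < t)
    (hlt : 1 ≤ l * t ^ α) :
    ∫ η in Ioc (0 : ℝ) t, η ^ (α - 1) / (1 + l * η ^ α)
      ≤ (1 / l) * (1 / α + (1 / α) * Real.log l + |Real.log t|) := by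
  have hl0 : 0 < l := by linarith
  have htα : 0 < t ^ α := Real.rpow_pos_of_pos ht α
  rw [integral_rpow_sub_one_div_one_add_mul_rpow hα hl0 ht.le]
  have hlog : Real.log (1 + l * t ^ α) ≤ 1 + Real.log l + α * |Real.log t| := by
    calc Real.log (1 + l * t ^ α) ≤ Real.log (2 * (l * t ^ α)) :=
          Real.log_le_log (by positivity) (by linarith)
      _ = Real.log 2 + (Real.log l + α * Real.log t) := by
          rw [Real.log_mul two_ne_zero (by positivity), Real.log_mul hl0.ne' htα.ne',
            Real.log_rpow ht]
      _ ≤ 1 + Real.log l + α * |Real.log t| := by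
          have h2 := Real.log_two_lt_d9
          have habs := mul_le_mul_of_nonneg_left (le_abs_self (Real.log t)) hα.le
          linarith
  calc Real.log (1 + l * t ^ α) / (α * l)
      ≤ (1 + Real.log l + α * |Real.log t|) / (α * l) := by gcongr
    _ = (1 / l) * (1 / α + (1 / α) * Real.log l + |Real.log t|) := by
        field_simp
end
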